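/- Let d ≥ 4, let a, b, c ∈ ℝ, and let ℓ be a real linear form in x, y. Set f = y^{d−1}·(a·x + b·y) + c·ℓ^d. Then f = 0, or the real Waring rank of f is at most d − 1, or f is hyperbolic. -/

import Mathlib

open scoped BigOperators
open MvPolynomial

/-- The real Waring rank of a binary form `f` of degree `d`: the least `r : ℕ∞` such that
`f = ∑ λᵢ ℓᵢ^d` for real numbers `λᵢ` and real linear forms `ℓᵢ` (`∞` if none exists). -/
noncomputable def waringRank (d : ℕ) (f : MvPolynomial (Fin 2) ℝ) : ℕ∞ :=
  sInf ((fun n : ℕ => (n : ℕ∞)) ''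
    {r : ℕ | ∃ lam : Fin r → ℝ, ∃ l : Fin r → ℝ × ℝ,
      f = ∑ i, C (lam i) * (C (l i).1 * X 0 + C (l i).2 * X 1) ^ d})

/-- A binary form of degree `d` is hyperbolic if it is a product of `d` real linear forms. -/
def Hyperbolic (d : ℕ) (f : MvPolynomial (Fin 2) ℝ) : Prop :=
  ∃ l : Fin d → ℝ × ℝ, f = ∏ i, (C (l i).1 * X 0 + C (l i).2 * X 1)

/-- For `n ≥ 3` there are `n` distinct real numbers with any prescribed sum and product. -/
theorem exists_injective_sum_prod (n : ℕ) (hn : 3 ≤ n) (s P : ℝ) :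
    ∃ t : Fin n → ℝ, Function.Injective t ∧ ∑ i, t i = s ∧ ∏ i, t i = P := by
  obtain ⟨m, rfl⟩ : ∃ m, n = m + 3 := ⟨n - 3, by omega⟩
  set M : ℝ := 1 + |s| + 2 * |P| with hM
  have hs := abs_nonneg s
  have hP := abs_nonneg P
  have hM1 : 1 ≤ M := by linarith
  let r : Fin (m + 1) → ℝ := fun i => M * ((i : ℕ) + 1)
  have hrM (i) : M ≤ r i := by
    have : (0 : ℝ) ≤ ((i : ℕ) : ℝ) := Nat.cast_nonneg _
    simp only [r]
    nlinarith
  have hr : Function.Injective r := fun i j hij => by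
    have h : ((i : ℕ) : ℝ) + 1 = (j : ℕ) + 1 := mul_left_cancel₀ (by linarith) hij
    exact Fin.ext (by exact_mod_cast add_right_cancel h)
  set S := ∑ i, r i with hS
  set Q := ∏ i, r i with hQ
  have hSM : M ≤ S := (hrM 0).trans
    (Finset.single_le_sum (fun i _ => by linarith [hrM i]) (Finset.mem_univ 0))
  have hQ1 : 1 ≤ Q := by
    simpa using Finset.prod_le_prod (s := Finset.univ) (f := fun _ : Fin (m + 1) => (1 : ℝ))
      (fun _ _ => zero_le_one) fun i _ => hM1.trans (hrM i)
  set w := P / Q with hw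
  have hwP : |w| ≤ |P| := by
    rw [hw, abs_div, abs_of_pos (by linarith : 0 < Q)]
    exact div_le_self hP hQ1
  have hw1 := abs_le.1 hwP
  have hs1 := le_abs_self s
  have hD : 0 < (s - S) ^ 2 - 4 * w := by nlinarith
  set e := √((s - S) ^ 2 - 4 * w) with he
  have he0 : 0 < e := Real.sqrt_pos.2 hD
  have hee : e ^ 2 = (s - S) ^ 2 - 4 * w := Real.sq_sqrt hD.le
  have hq (i) : 0 < r i ^ 2 - (s - S) * r i + w := by
    have := hrM i
    nlinarith
  refine ⟨Fin.cons ((s - S + e) / 2) (Fin.cons ((s - S - e) / 2) r), ?_, ?_, ?_⟩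
  · rw [Fin.cons_injective_iff, Fin.cons_injective_iff]
    refine ⟨?_, ?_, hr⟩
    · rintro ⟨i, hi⟩
      induction i using Fin.cases with
      | zero => simp only [Fin.cons_zero] at hi; linarith
      | succ i => simp only [Fin.cons_succ] at hi; have := hq i; rw [hi] at this; nlinarith
    · rintro ⟨i, hi⟩
      have := hq i
      rw [hi] at this
      nlinarith
  · simp only [Fin.sum_univ_succ (n := m + 2), Fin.sum_univ_succ (n := m + 1), Fin.cons_zero,
      Fin.cons_succ, ← hS]
    ring
  · simp only [Fin.prod_univ_succ (n := m + 2), Fin.prod_univ_succ (n := m + 1), Fin.cons_zero,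
      Fin.cons_succ, ← hQ]
    have : w * Q = P := div_mul_cancel₀ _ (by linarith)
    linear_combination this - Q / 4 * hee

/-- Distinct nodes `t` carry weights whose moments of order `1, …, n - 1` vanish, and whose
moments of order `0`, `n` and `n + 1` are determined by the sum and the product of the nodes. -/
theorem exists_weights_moments {n : ℕ} (hn : 2 ≤ n) {t : Fin n → ℝ}
    (ht : Function.Injective t) (c : ℝ) :
    ∃ w : Fin n → ℝ, ∑ i, w i = c ∧ (∀ k, 0 < k → k < n → ∑ i, w i * t i ^ k = 0) ∧
      ∑ i, w i * t i ^ n = -(c * ∏ i, -t i) ∧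
      ∑ i, w i * t i ^ (n + 1) = -((∑ i, t i) * (c * ∏ i, -t i)) := by
  let w : Fin n → ℝ := fun i => c * (Lagrange.basis Finset.univ t i).eval 0
  have hL (p : Polynomial ℝ) (hp : p.degree < n) : ∑ i, w i * p.eval (t i) = c * p.eval 0 := by
    have h := Lagrange.eq_interpolate (s := Finset.univ) (v := t) (f := p) ht.injOn
      (by simpa using hp)
    conv_rhs => rw [h, Lagrange.interpolate_apply, Polynomial.eval_finsetSum, Finset.mul_sum]
    refine Finset.sum_congr rfl fun i _ => ?_
    simp only [w, Polynomial.eval_mul, Polynomial.eval_C]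
    ring
  let g : Polynomial ℝ := ∏ i, (Polynomial.X - Polynomial.C (t i))
  have hgm : g.Monic := Polynomial.monic_prod_of_monic _ _ fun i _ => Polynomial.monic_X_sub_C _
  have hgd : g.natDegree = n := by simp [g]
  have hg0 : g.eval 0 = ∏ i, -t i := by simp [g, Polynomial.eval_prod]
  have hgt (i) : g.eval (t i) = 0 := by
    simp only [g, Polynomial.eval_prod]
    exact Finset.prod_eq_zero (Finset.mem_univ i) (by simp)
  have hgn : g.coeff (n - 1) = -∑ i, t i := by
    have h := Polynomial.prod_X_sub_C_nextCoeff (s := Finset.univ) t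
    rwa [Polynomial.nextCoeff_of_natDegree_pos (by change 0 < g.natDegree; omega),
      show (∏ i, (Polynomial.X - Polynomial.C (t i))) = g from rfl, hgd] at h
  have hn' : ∑ i, w i * t i ^ n = -(c * ∏ i, -t i) := by
    have h := hL (Polynomial.X ^ n - g) (by
      rw [Polynomial.degree_lt_iff_coeff_zero]
      intro k hk
      rcases hk.eq_or_lt with rfl | hk
      · have := hgm.coeff_natDegree
        rw [hgd] at this
        simp [this]
      · rw [Polynomial.coeff_sub, Polynomial.coeff_X_pow, if_neg hk.ne',
          Polynomial.coeff_eq_zero_of_natDegree_lt (by omega), sub_zero])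
    simpa [hgt, hg0, show n ≠ 0 by omega] using h
  refine ⟨w, ?_, ?_, hn', ?_⟩
  · simpa using hL 1 (by rw [Polynomial.degree_one]; exact_mod_cast (by omega : 0 < n))
  · intro k hk hkn
    simpa [hk.ne'] using
      hL (Polynomial.X ^ k) (by rw [Polynomial.degree_X_pow]; exact_mod_cast hkn)
  · have h := hL (Polynomial.X ^ (n + 1) - Polynomial.X * g
        - Polynomial.C (∑ i, t i) * Polynomial.X ^ n) (by
      rw [Polynomial.degree_lt_iff_coeff_zero]
      intro k hk
      obtain ⟨j, rfl⟩ : ∃ j, k = j + 1 := ⟨k - 1, by omega⟩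
      rw [Polynomial.coeff_sub, Polynomial.coeff_sub, Polynomial.coeff_X_mul,
        Polynomial.coeff_C_mul, Polynomial.coeff_X_pow, Polynomial.coeff_X_pow]
      rcases hk.eq_or_lt with rfl | hk
      · simp at hgn
        simp [hgn]
      · rw [if_neg (show j + 1 ≠ n by omega)]
        by_cases hj : j = n
        · subst hj
          have := hgm.coeff_natDegree
          rw [hgd] at this
          simp [this]
        · rw [if_neg (by omega), Polynomial.coeff_eq_zero_of_natDegree_lt (by omega)]
          simp)
    simp only [Polynomial.eval_sub, Polynomial.eval_mul, Polynomial.eval_pow, Polynomial.eval_X,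
      Polynomial.eval_C, hgt, mul_zero, sub_zero, zero_mul, mul_sub, Finset.sum_sub_distrib,
      zero_pow (show n ≠ 0 by omega), zero_pow (Nat.succ_ne_zero n)] at h
    have h2 : ∑ i, w i * ((∑ j, t j) * t i ^ n) = (∑ j, t j) * ∑ i, w i * t i ^ n := by
      rw [Finset.mul_sum]
      exact Finset.sum_congr rfl fun i _ => by ring
    rw [h2, hn'] at h
    linarith

/-- For `d ≥ 4`, a form `a u v^{d-1} + b v^d + c u^d` with `a, c ≠ 0` is a combination of `d - 1`
powers of the shape `(u + t v)^d`. -/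
theorem exists_sum_pow_eq {A : Type*} [CommRing A] [Algebra ℝ A] (n : ℕ) (hn : 3 ≤ n)
    {a b c : ℝ} (ha : a ≠ 0) (hc : c ≠ 0) (u v : A) :
    ∃ w t : Fin n → ℝ, ∑ i, algebraMap ℝ A (w i) * (u + algebraMap ℝ A (t i) * v) ^ (n + 1) =
      algebraMap ℝ A a * (u * v ^ n) + algebraMap ℝ A b * v ^ (n + 1)
        + algebraMap ℝ A c * u ^ (n + 1) := by
  have hn1 : ((n : ℝ) + 1) ≠ 0 := by positivity
  obtain ⟨t, ht, hs, hp⟩ := exists_injective_sum_prod n hn (b * (n + 1) / a)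
    ((-1) ^ n * (-a / ((n + 1) * c)))
  obtain ⟨w, h0, hk, h1, h2⟩ := exists_weights_moments (by omega) ht c
  have hpn : ∏ i, -t i = -a / ((n + 1) * c) := by
    rw [Finset.prod_neg, hp, Finset.card_univ, Fintype.card_fin, ← mul_assoc, ← mul_pow]
    simp
  rw [hpn] at h1 h2
  rw [hs] at h2
  have h1' : (n + 1) * ∑ i, w i * t i ^ n = a := by rw [h1]; field_simp
  have h2' : ∑ i, w i * t i ^ (n + 1) = b := by rw [h2]; field_simp
  refine ⟨w, t, ?_⟩
  have key : ∑ i, algebraMap ℝ A (w i) * (u + algebraMap ℝ A (t i) * v) ^ (n + 1) =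
      ∑ k ∈ Finset.range (n + 2), algebraMap ℝ A (((n + 1).choose k : ℝ) * ∑ i, w i * t i ^ k) *
        (v ^ k * u ^ (n + 1 - k)) := by
    simp only [add_comm u, add_pow, Finset.mul_sum, map_sum, Finset.sum_mul]
    rw [Finset.sum_comm]
    refine Finset.sum_congr rfl fun k _ => Finset.sum_congr rfl fun i _ => ?_
    simp only [map_mul, map_pow, map_natCast]
    ring
  rw [key, Finset.sum_range_succ, Finset.sum_range_succ, Finset.sum_eq_single 0, h2']
  · simp only [Nat.choose_succ_self_right, Nat.cast_add, Nat.cast_one, h1', pow_zero, mul_one, h0,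
      Nat.choose_zero_right, Nat.choose_self, one_mul, Nat.sub_zero, Nat.sub_self,
      Nat.add_sub_cancel_left, pow_one]
    ring
  · intro k hk' hk0
    rw [hk k (by omega) (Finset.mem_range.1 hk'), mul_zero, map_zero, zero_mul]
  · intro h
    exact absurd (Finset.mem_range.2 (by omega)) h

theorem waringRank_le {d r : ℕ} {f : MvPolynomial (Fin 2) ℝ} (w : Fin r → ℝ) (l : Fin r → ℝ × ℝ)
    (h : f = ∑ i, C (w i) * (C (l i).1 * X 0 + C (l i).2 * X 1) ^ d) :
    waringRank d f ≤ r :=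
  sInf_le ⟨r, ⟨w, l, h⟩, rfl⟩

theorem hyperbolic_X_pow_mul (n : ℕ) (a b : ℝ) :
    Hyperbolic (n + 1) (X 1 ^ n * (C a * X 0 + C b * X 1)) :=
  ⟨Fin.cons (a, b) fun _ => (0, 1), by simp [Fin.prod_univ_succ, mul_comm]⟩

/-- For `d ≥ 4`, a form `f = y^{d-1}(a x + b y) + c ℓ^d` is zero, or has real Waring rank at
most `d - 1`, or is hyperbolic. -/
theorem statement12 (d : ℕ) (hd : 4 ≤ d) (a b c : ℝ) (l : ℝ × ℝ)
    (f : MvPolynomial (Fin 2) ℝ)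
    (hf : f = X 1 ^ (d - 1) * (C a * X 0 + C b * X 1) +
      C c * (C l.1 * X 0 + C l.2 * X 1) ^ d) :
    f = 0 ∨ waringRank d f ≤ (d - 1 : ℕ) ∨ Hyperbolic d f := by
  obtain ⟨n, rfl⟩ : ∃ n, d = n + 1 := ⟨d - 1, by omega⟩
  obtain ⟨p, q⟩ := l
  simp only [Nat.add_sub_cancel] at hf ⊢
  right
  by_cases hc : c = 0
  · right
    rw [hf, hc]
    simpa using hyperbolic_X_pow_mul n a b
  by_cases hp : p = 0
  · right
    have h : f = X 1 ^ n * (C a * X 0 + C (b + c * q ^ (n + 1)) * X 1) := by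
      rw [hf, hp]
      simp only [map_add, map_mul, map_pow, map_zero]
      ring
    rw [h]
    exact hyperbolic_X_pow_mul n a _
  left
  by_cases ha : a = 0
  · refine (waringRank_le ![b, c] ![(0, 1), (p, q)] ?_).trans
      (by exact_mod_cast (by omega : 2 ≤ n))
    simp only [hf, ha, Fin.sum_univ_two, Matrix.cons_val_zero, Matrix.cons_val_one, map_zero,
      map_one]
    ring
  obtain ⟨w, t, h⟩ := exists_sum_pow_eq (A := MvPolynomial (Fin 2) ℝ) n (by omega)
    (b := b - a * q / p) (div_ne_zero ha hp) hc (C p * X 0 + C q * X 1) (X 1)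
  refine waringRank_le w (fun i => (p, q + t i)) ?_
  have hap : (C a : MvPolynomial (Fin 2) ℝ) = C (a / p) * C p := by
    rw [← C_mul, div_mul_cancel₀ _ hp]
  have haq : (C (a * q / p) : MvPolynomial (Fin 2) ℝ) = C (a / p) * C q := by
    rw [← C_mul]
    congr 1
    ring
  calc f = C (a / p) * ((C p * X 0 + C q * X 1) * X 1 ^ n) + C (b - a * q / p) * X 1 ^ (n + 1)
        + C c * (C p * X 0 + C q * X 1) ^ (n + 1) := by
        rw [hf, C_sub, haq, hap]
        ring
    _ = _ := h.symm
    _ = _ := Finset.sum_congr rfl fun i _ => by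
        rw [algebraMap_eq, C_add]
        ring
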